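/- (Stengle's Corollary) Let f₁,…,f_{n₁}, h₁,…,h_{n₃} ∈ ℝ[x₁,…,xₙ], let P be the cone generated by f₁,…,f_{n₁}, let I be the ideal generated by h₁,…,h_{n₃}, and set S = {x ∈ ℝⁿ : fᵢ(x) ≥ 0 for i = 1,…,n₁ and hⱼ(x) = 0 for j = 1,…,n₃}. Then for p ∈ ℝ[x₁,…,xₙ], p(x) > 0 for all x ∈ S if and only if there exist σ, τ ∈ P and h ∈ I such that p·σ = 1 + τ + h. -/

import Mathlib

open MvPolynomial

/-- A polynomial is a sum of squares if it is a finite sum of squares of polynomials. -/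
def IsSOS {σ : Type*} (p : MvPolynomial σ ℝ) : Prop :=
  ∃ (m : ℕ) (f : Fin m → MvPolynomial σ ℝ), p = ∑ i, f i ^ 2

/-- Membership in the cone generated by `f₁, …, f_{n₁}`. -/
def InCone {n n₁ : ℕ} (f : Fin n₁ → MvPolynomial (Fin n) ℝ)
    (p : MvPolynomial (Fin n) ℝ) : Prop :=
  ∃ (s₀ : MvPolynomial (Fin n) ℝ) (T : Finset (Fin n₁ → ℕ))
    (s : (Fin n₁ → ℕ) → MvPolynomial (Fin n) ℝ),
    IsSOS s₀ ∧ (∀ k ∈ T, IsSOS (s k)) ∧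
      p = s₀ + ∑ k ∈ T, s k * ∏ i, f i ^ k i

/-- Membership in the ideal generated by `h₁, …, h_{n₃}`: the polynomials `Σₖ qₖ hₖ`. -/
def InIdeal {n n₃ : ℕ} (h : Fin n₃ → MvPolynomial (Fin n) ℝ)
    (p : MvPolynomial (Fin n) ℝ) : Prop :=
  ∃ q : Fin n₃ → MvPolynomial (Fin n) ℝ, p = ∑ k, q k * h k

open Polynomial in
/-- The intermediate value property for polynomials over an ordered field. -/
def PolyIVT (R : Type*) [Field R] [LinearOrder R] : Prop :=
  ∀ (f : R[X]) (a b : R), a < b → f.eval a * f.eval b < 0 →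
    ∃ c, a < c ∧ c < b ∧ f.eval c = 0

section Rolle

open Polynomial

variable {R : Type*} [Field R] [LinearOrder R] [IsStrictOrderedRing R]

theorem PolyIVT.rolle_of_no_root (hR : PolyIVT R) {f : R[X]} {a b : R} (hab : a < b)
    (ha : f.eval a = 0) (hb : f.eval b = 0) (hroot : ∀ c, a < c → c < b → f.eval c ≠ 0) :
    ∃ c, a < c ∧ c < b ∧ f.derivative.eval c = 0 := by
  have hf : f ≠ 0 := by
    rintro rfl
    obtain ⟨c, h1, h2⟩ := exists_between hab
    exact hroot c h1 h2 (by simp)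
  obtain ⟨u, hu, hua⟩ := exists_eq_pow_rootMultiplicity_mul_and_not_dvd f hf a
  have hm : 0 < f.rootMultiplicity a := (rootMultiplicity_pos hf).2 ha
  obtain ⟨m, hm'⟩ := Nat.exists_eq_add_of_lt hm
  rw [hm'] at hu
  have hu0 : u ≠ 0 := by rintro rfl; simp at hua
  have hub : u.eval b = 0 := by
    have := hb
    rw [hu] at this
    simpa [sub_eq_zero, hab.ne'] using this
  obtain ⟨g, hg, hgb⟩ := exists_eq_pow_rootMultiplicity_mul_and_not_dvd u hu0 b
  have hn : 0 < u.rootMultiplicity b := (rootMultiplicity_pos hu0).2 hub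
  obtain ⟨n, hn'⟩ := Nat.exists_eq_add_of_lt hn
  rw [hn'] at hg
  simp only [zero_add] at hu hg
  have hga : g.eval a ≠ 0 := by
    intro h
    apply hua
    rw [dvd_iff_isRoot, IsRoot.def, hg]
    simp [h]
  rw [dvd_iff_isRoot, IsRoot.def] at hgb
  have hgab : 0 < g.eval a * g.eval b := by
    by_contra hneg
    obtain ⟨c, h1, h2, h3⟩ := hR g a b hab
      (lt_of_le_of_ne (not_lt.1 hneg) (mul_ne_zero hga hgb))
    exact hroot c h1 h2 (by rw [hu, hg]; simp [h3])
  set h : R[X] := (Polynomial.C (m + 1 : R) * (Polynomial.X - Polynomial.C b) +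
    Polynomial.C (n + 1 : R) * (Polynomial.X - Polynomial.C a)) * g
    + (Polynomial.X - Polynomial.C a) * (Polynomial.X - Polynomial.C b) * derivative g with hh
  have hder : derivative f = (Polynomial.X - Polynomial.C a) ^ m * (Polynomial.X - Polynomial.C b) ^ n *
      h := by
    rw [hu, hg, hh]
    simp [derivative_mul, derivative_pow]
    ring
  have hha : h.eval a = (m + 1) * (a - b) * g.eval a := by simp [hh]
  have hhb : h.eval b = (n + 1) * (b - a) * g.eval b := by simp [hh]
  obtain ⟨c, h1, h2, h3⟩ := hR h a b hab (by
    rw [hha, hhb]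
    have h1 : (0 : R) < (m + 1) * (n + 1) := by positivity
    have h2 : 0 < (b - a) * (b - a) := mul_pos (sub_pos.2 hab) (sub_pos.2 hab)
    have := mul_pos (mul_pos h1 h2) hgab
    linarith)
  exact ⟨c, h1, h2, by rw [hder]; simp [h3]⟩

theorem PolyIVT.rolle (hR : PolyIVT R) {f : R[X]} {a b : R} (hab : a < b)
    (ha : f.eval a = 0) (hb : f.eval b = 0) :
    ∃ c, a < c ∧ c < b ∧ f.derivative.eval c = 0 := by
  by_cases hf : f = 0
  · obtain ⟨c, h1, h2⟩ := exists_between hab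
    exact ⟨c, h1, h2, by simp [hf]⟩
  have hne : (f.roots.toFinset.filter (a < ·)).Nonempty :=
    ⟨b, by simp [hf, hab, hb]⟩
  obtain ⟨d, hd, hmin⟩ := Finset.exists_min_image _ id hne
  simp only [Finset.mem_filter, Multiset.mem_toFinset, mem_roots hf, IsRoot.def, id] at hd hmin
  obtain ⟨c, h1, h2, h3⟩ := hR.rolle_of_no_root hd.2 ha hd.1
    fun c h1 h2 h3 => (hmin c ⟨h3, h1⟩).not_gt h2
  exact ⟨c, h1, h2.trans_le (hmin b ⟨hb, hab⟩), h3⟩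

theorem PolyIVT.eval_lt_eval (hR : PolyIVT R) {f : R[X]} {a b : R} (hab : a < b)
    (hf : ∀ c, a < c → c < b → 0 < f.derivative.eval c) : f.eval a < f.eval b := by
  have hba : b - a ≠ 0 := (sub_pos.2 hab).ne'
  obtain ⟨c, h1, h2, h3⟩ := hR.rolle
    (f := f - Polynomial.C (f.eval a) -
      Polynomial.C ((f.eval b - f.eval a) / (b - a)) * (Polynomial.X - Polynomial.C a)) hab
    (by simp) (by simp; field_simp; ring)
  have h4 := hf c h1 h2
  simp [sub_eq_zero] at h3
  rw [h3, div_pos_iff_of_pos_right (sub_pos.2 hab)] at h4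
  exact sub_pos.1 h4

end Rolle

section Infinity

open Polynomial

variable {R : Type*} [Field R] [LinearOrder R] [IsStrictOrderedRing R]

theorem Polynomial.exists_forall_lt_eval (d : ℕ) : ∀ f : R[X], f.natDegree = d + 1 →
    0 < f.leadingCoeff → ∀ B : R, ∃ M, ∀ x, M ≤ x → B < f.eval x := by
  induction d with
  | zero =>
    intro f hd hl B
    rw [eq_X_add_C_of_natDegree_le_one hd.le]
    rw [leadingCoeff, hd] at hl
    simp only [zero_add] at hl
    refine ⟨(B - f.coeff 0) / f.coeff 1 + 1, fun x hx => ?_⟩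
    have : (B - f.coeff 0) / f.coeff 1 < x := by linarith
    rw [div_lt_iff₀ hl] at this
    simp
    linarith
  | succ d ih =>
    intro f hd hl B
    have hd' : f.divX.natDegree = d + 1 := by rw [natDegree_divX_eq_natDegree_tsub_one, hd]; rfl
    obtain ⟨M, hM⟩ := ih f.divX hd' (by
      rw [leadingCoeff, hd', coeff_divX, ← hd]; exact hl) 1
    refine ⟨max (max M 1) (B - f.coeff 0 + 1), fun x hx => ?_⟩
    have h1 : M ≤ x := (le_max_left _ _).trans ((le_max_left _ _).trans hx)
    have h2 : 1 ≤ x := (le_max_right _ _).trans ((le_max_left _ _).trans hx)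
    have h3 : B - f.coeff 0 + 1 ≤ x := (le_max_right _ _).trans hx
    have h4 := hM x h1
    rw [← divX_mul_X_add f]
    simp
    nlinarith

theorem Polynomial.exists_forall_sign_eval (f : R[X]) :
    ∃ M, ∀ x, M ≤ x → SignType.sign (f.eval x) = SignType.sign f.leadingCoeff := by
  rcases Nat.eq_zero_or_eq_succ_pred f.natDegree with h | h
  · refine ⟨0, fun x _ => ?_⟩
    rw [eq_C_of_natDegree_eq_zero h]
    simp
  · rcases lt_trichotomy f.leadingCoeff 0 with hl | hl | hl
    · obtain ⟨M, hM⟩ := exists_forall_lt_eval _ (-f) (by rwa [natDegree_neg])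
        (by simpa using hl) 0
      refine ⟨M, fun x hx => ?_⟩
      rw [sign_neg hl, sign_neg (by simpa using hM x hx)]
    · exact ⟨0, fun x _ => by simp [leadingCoeff_eq_zero.1 hl]⟩
    · obtain ⟨M, hM⟩ := exists_forall_lt_eval _ f h hl 0
      exact ⟨M, fun x hx => by rw [sign_pos hl, sign_pos (hM x hx)]⟩

theorem Polynomial.exists_forall_sign_eval₂ {k : Type*} [Field k] (φ : k →+* R)
    (F : Finset k[X]) :
    ∃ M, ∀ q ∈ F, ∀ x, M ≤ x →
      SignType.sign (q.eval₂ φ x) = SignType.sign (φ q.leadingCoeff) ∧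
      SignType.sign (q.eval₂ φ (-x)) = SignType.sign (φ (q.comp (-Polynomial.X)).leadingCoeff) := by
  have key (q : k[X]) : ∃ M, ∀ x, M ≤ x →
      SignType.sign (q.eval₂ φ x) = SignType.sign (φ q.leadingCoeff) := by
    obtain ⟨M, hM⟩ := exists_forall_sign_eval (q.map φ)
    refine ⟨M, fun x hx => ?_⟩
    rw [← eval_map, hM x hx, leadingCoeff_map]
  choose M hM using key
  refine ⟨∑ q ∈ F, (|M q| + |M (q.comp (-Polynomial.X))|), fun q hq x hx => ?_⟩
  have h1 : |M q| + |M (q.comp (-Polynomial.X))| ≤ x :=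
    (Finset.single_le_sum (f := fun q => |M q| + |M (q.comp (-Polynomial.X))|)
      (fun i _ => by positivity) hq).trans hx
  have h2 := le_abs_self (M q)
  have h3 := le_abs_self (M (q.comp (-Polynomial.X)))
  have h4 := abs_nonneg (M q)
  have h5 := abs_nonneg (M (q.comp (-Polynomial.X)))
  refine ⟨hM q x (by linarith), ?_⟩
  rw [← hM (q.comp (-Polynomial.X)) x (by linarith)]
  simp [eval₂_comp]

end Infinity

section Closure

open Polynomial

variable {k : Type*} [Field k]

theorem Polynomial.exists_finset_closed [CharZero k] [DecidableEq k[X]] (d : ℕ) :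
    ∀ B F : Finset k[X], (∀ q ∈ F, q.degree < d) →
    ∃ G : Finset k[X], F ⊆ G ∧ (∀ q ∈ G, q.degree < d) ∧ (∀ q ∈ G, derivative q ∈ G) ∧
      ∀ b ∈ B ∪ G, ∀ g ∈ G, g ≠ 0 → b % g ∈ G := by
  induction d with
  | zero =>
    intro B F hF
    have h0 : ∀ q ∈ F, q = 0 := fun q hq => by
      have := hF q hq
      rwa [Nat.cast_zero, Nat.WithBot.lt_zero_iff, degree_eq_bot] at this
    refine ⟨F, subset_rfl, hF, fun q hq => ?_, fun b _ g hg hg0 => (hg0 (h0 g hg)).elim⟩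
    rw [h0 q hq, derivative_zero, ← h0 q hq]
    exact hq
  | succ d ih =>
    intro B F hF
    set T := F.filter (fun q => q.degree = (d : WithBot ℕ)) with hT
    have hT0 : ∀ t ∈ T, t ≠ 0 := by
      rintro t ht rfl
      simp [hT] at ht
    obtain ⟨G, hFG, hdeg, hder, hmod⟩ := ih (B ∪ T)
      (F.filter (fun q => q.degree < (d : WithBot ℕ)) ∪ T.image derivative ∪
        ((B ∪ T) ×ˢ T).image (fun p => p.1 % p.2)) (by
      intro q hq
      simp only [Finset.mem_union, Finset.mem_image, Finset.mem_filter, Finset.mem_product] at hq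
      rcases hq with (⟨_, hq⟩ | ⟨t, ht, rfl⟩) | ⟨⟨b, t⟩, ⟨_, ht⟩, rfl⟩
      · exact hq
      · rw [← (Finset.mem_filter.1 ht).2]
        exact degree_derivative_lt (hT0 t ht)
      · rw [← (Finset.mem_filter.1 ht).2]
        exact degree_mod_lt _ (hT0 t ht))
    refine ⟨G ∪ T, fun q hq => ?_, fun q hq => ?_, fun q hq => ?_, fun b hb g hg hg0 => ?_⟩
    · have hle : q.degree ≤ d := by
        by_cases hq0 : q = 0
        · simp [hq0]
        · have := hF q hq
          rw [degree_eq_natDegree hq0] at this ⊢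
          exact_mod_cast Nat.lt_succ_iff.1 (by exact_mod_cast this)
      rcases lt_or_eq_of_le hle with h | h
      · exact Finset.mem_union_left _ (hFG (by simp [hq, h]))
      · exact Finset.mem_union_right _ (by simp [hT, hq, h])
    · rcases Finset.mem_union.1 hq with h | h
      · exact (hdeg q h).trans (by exact_mod_cast Nat.lt_succ_self d)
      · exact hF q (Finset.mem_filter.1 h).1
    · rcases Finset.mem_union.1 hq with h | h
      · exact Finset.mem_union_left _ (hder q h)
      · refine Finset.mem_union_left _ (hFG ?_)
        exact Finset.mem_union_left _ (Finset.mem_union_right _ (Finset.mem_image_of_mem _ h))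
    · refine Finset.mem_union_left _ ?_
      rcases Finset.mem_union.1 hg with h | h
      · refine hmod b ?_ g h hg0
        simp only [Finset.mem_union] at hb ⊢
        tauto
      · by_cases hbG : b ∈ G
        · rwa [mod_eq_self_iff hg0 |>.2]
          rw [(Finset.mem_filter.1 h).2]
          exact hdeg b hbG
        · refine hFG (Finset.mem_union_right _ (Finset.mem_image.2 ⟨(b, g), ?_, rfl⟩))
          simp only [Finset.mem_union, Finset.mem_product] at hb ⊢
          tauto

end Closure

section Transfer

open Polynomial

variable {k R R₂ : Type*} [Field k] [Field R] [LinearOrder R] [IsStrictOrderedRing R]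
  [Field R₂] [LinearOrder R₂] [IsStrictOrderedRing R₂]

theorem PolyIVT.strictMonoOn (hR : PolyIVT R) {f : R[X]} {a b : R}
    (hf : ∀ c, a < c → c < b → 0 < f.derivative.eval c) :
    StrictMonoOn (fun x => f.eval x) (Set.Icc a b) := fun _ hx _ hy hxy =>
  hR.eval_lt_eval hxy fun c h1 h2 => hf c (hx.1.trans_lt h1) (h2.trans_le hy.2)

/-- On an interval where the derivative is positive, the signs of the values of a polynomial
are determined by its signs at the end points. -/
theorem PolyIVT.sign_of_derivative_pos (hR : PolyIVT R) {f : R[X]} {a b : R} (hab : a < b)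
    (hf : ∀ c, a < c → c < b → 0 < f.derivative.eval c) :
    (0 ≤ f.eval a → ∀ x, a < x → x < b → SignType.sign (f.eval x) = 1) ∧
    (f.eval b ≤ 0 → ∀ x, a < x → x < b → SignType.sign (f.eval x) = -1) ∧
    (f.eval a < 0 → 0 < f.eval b → ∃ c, a < c ∧ c < b ∧ ∀ x, a < x → x < b →
      SignType.sign (f.eval x) = SignType.sign (x - c)) := by
  have hm := hR.strictMonoOn hf
  refine ⟨fun h x h1 h2 => ?_, fun h x h1 h2 => ?_, fun h h' => ?_⟩
  · exact sign_pos (h.trans_lt (hm ⟨le_rfl, hab.le⟩ ⟨h1.le, h2.le⟩ h1))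
  · exact sign_neg ((hm ⟨h1.le, h2.le⟩ ⟨hab.le, le_rfl⟩ h2).trans_le h)
  · obtain ⟨c, h1, h2, h3⟩ := hR f a b hab (mul_neg_of_neg_of_pos h h')
    refine ⟨c, h1, h2, fun x hx hx' => ?_⟩
    rcases lt_trichotomy x c with hc | rfl | hc
    · have := hm ⟨hx.le, hx'.le⟩ ⟨h1.le, h2.le⟩ hc
      simp only [h3] at this
      rw [sign_neg this, sign_neg (sub_neg.2 hc)]
    · simp [h3]
    · have := hm ⟨h1.le, h2.le⟩ ⟨hx.le, hx'.le⟩ hc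
      simp only [h3] at this
      rw [sign_pos this, sign_pos (sub_pos.2 hc)]

theorem PolyIVT.sign_transfer_pos (hR : PolyIVT R) (hR' : PolyIVT R₂) {f : R[X]} {f' : R₂[X]}
    {a b : R} {a' b' : R₂} (hab : a < b) (hab' : a' < b')
    (hf : ∀ c, a < c → c < b → 0 < f.derivative.eval c)
    (hf' : ∀ c, a' < c → c < b' → 0 < f'.derivative.eval c)
    (ha : SignType.sign (f.eval a) = SignType.sign (f'.eval a'))
    (hb : SignType.sign (f.eval b) = SignType.sign (f'.eval b')) :
    (∃ s : SignType, s ≠ 0 ∧ (∀ x, a < x → x < b → SignType.sign (f.eval x) = s) ∧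
      ∀ x, a' < x → x < b' → SignType.sign (f'.eval x) = s) ∨
    ∃ s : SignType, s ≠ 0 ∧ ∃ c c', a < c ∧ c < b ∧ a' < c' ∧ c' < b' ∧
      (∀ x, a < x → x < b → SignType.sign (f.eval x) = s * SignType.sign (x - c)) ∧
      ∀ x, a' < x → x < b' → SignType.sign (f'.eval x) = s * SignType.sign (x - c') := by
  obtain ⟨h1, h2, h3⟩ := hR.sign_of_derivative_pos hab hf
  obtain ⟨h1', h2', h3'⟩ := hR'.sign_of_derivative_pos hab' hf'
  by_cases hA : 0 ≤ f.eval a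
  · exact .inl ⟨1, by decide, h1 hA, h1' (by rwa [← sign_nonneg_iff, ← ha, sign_nonneg_iff])⟩
  by_cases hB : f.eval b ≤ 0
  · exact .inl ⟨-1, by decide, h2 hB, h2' (by rwa [← sign_nonpos_iff, ← hb, sign_nonpos_iff])⟩
  rw [not_le] at hA hB
  obtain ⟨c, hc1, hc2, hc⟩ := h3 hA hB
  obtain ⟨c', hc1', hc2', hc'⟩ := h3'
    (by rwa [← sign_eq_neg_one_iff, ← ha, sign_eq_neg_one_iff])
    (by rwa [← sign_eq_one_iff, ← hb, sign_eq_one_iff])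
  exact .inr ⟨1, by decide, c, c', hc1, hc2, hc1', hc2', by simpa using hc, by simpa using hc'⟩

theorem PolyIVT.sign_transfer (hR : PolyIVT R) (hR' : PolyIVT R₂) {f : R[X]} {f' : R₂[X]}
    {a b : R} {a' b' : R₂} (hab : a < b) (hab' : a' < b') {s : SignType} (hs : s ≠ 0)
    (hf : ∀ c, a < c → c < b → SignType.sign (f.derivative.eval c) = s)
    (hf' : ∀ c, a' < c → c < b' → SignType.sign (f'.derivative.eval c) = s)
    (ha : SignType.sign (f.eval a) = SignType.sign (f'.eval a'))
    (hb : SignType.sign (f.eval b) = SignType.sign (f'.eval b')) :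
    (∃ s : SignType, s ≠ 0 ∧ (∀ x, a < x → x < b → SignType.sign (f.eval x) = s) ∧
      ∀ x, a' < x → x < b' → SignType.sign (f'.eval x) = s) ∨
    ∃ s : SignType, s ≠ 0 ∧ ∃ c c', a < c ∧ c < b ∧ a' < c' ∧ c' < b' ∧
      (∀ x, a < x → x < b → SignType.sign (f.eval x) = s * SignType.sign (x - c)) ∧
      ∀ x, a' < x → x < b' → SignType.sign (f'.eval x) = s * SignType.sign (x - c') := by
  rcases SignType.trichotomy s with rfl | rfl | rfl
  · have := hR.sign_transfer_pos hR' (f := -f) (f' := -f') hab hab'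
      (fun c h1 h2 => by simpa [sign_eq_neg_one_iff] using hf c h1 h2)
      (fun c h1 h2 => by simpa [sign_eq_neg_one_iff] using hf' c h1 h2)
      (by simp [Left.sign_neg, ha]) (by simp [Left.sign_neg, hb])
    simp only [Polynomial.eval_neg, Left.sign_neg, neg_eq_iff_eq_neg, ← neg_mul] at this
    rcases this with ⟨s, hs, h⟩ | ⟨s, hs, h⟩
    · exact .inl ⟨-s, by simpa using hs, h⟩
    · exact .inr ⟨-s, by simpa using hs, h⟩
  · exact (hs rfl).elim
  · exact hR.sign_transfer_pos hR' hab hab' (fun c h1 h2 => sign_eq_one_iff.1 (hf c h1 h2))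
      (fun c h1 h2 => sign_eq_one_iff.1 (hf' c h1 h2)) ha hb

end Transfer

section SignedStep

open Polynomial

variable {k R R₂ : Type*} [Field k] [Field R] [LinearOrder R]
  [Field R₂] [LinearOrder R₂]

/-- A pair of points at which all polynomials of `Φ` have the same signs. -/
def SignNode (φ : k →+* R) (ψ : k →+* R₂) (Φ : Finset k[X]) (P : R × R₂) : Prop :=
  ∀ q ∈ Φ, SignType.sign (q.eval₂ φ P.1) = SignType.sign (q.eval₂ ψ P.2)

/-- A pair of open intervals on which each polynomial of `F` has the same constant sign, the
end points being nodes for `Φ`. -/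
structure SignStep (φ : k →+* R) (ψ : k →+* R₂) (Φ F : Finset k[X]) (P Q : R × R₂) : Prop where
  fst_lt : P.1 < Q.1
  snd_lt : P.2 < Q.2
  left : SignNode φ ψ Φ P
  right : SignNode φ ψ Φ Q
  sign : ∀ q ∈ F, ∃ s : SignType, (q ≠ 0 → s ≠ 0) ∧
    (∀ x, P.1 < x → x < Q.1 → SignType.sign (q.eval₂ φ x) = s) ∧
    ∀ x, P.2 < x → x < Q.2 → SignType.sign (q.eval₂ ψ x) = s

variable {φ : k →+* R} {ψ : k →+* R₂} {Φ F : Finset k[X]}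

theorem SignStep.insert_of_sign {P Q : R × R₂} {p : k[X]} [DecidableEq k[X]]
    (h : SignStep φ ψ Φ F P Q) {s : SignType} (hs : p ≠ 0 → s ≠ 0)
    (h1 : ∀ x, P.1 < x → x < Q.1 → SignType.sign (p.eval₂ φ x) = s)
    (h2 : ∀ x, P.2 < x → x < Q.2 → SignType.sign (p.eval₂ ψ x) = s) :
    SignStep φ ψ Φ (insert p F) P Q where
  __ := h
  sign q hq := by
    rcases Finset.mem_insert.1 hq with rfl | hq
    · exact ⟨s, hs, h1, h2⟩
    · exact h.sign q hq

theorem SignStep.mono {P Q P' Q' : R × R₂} (h : SignStep φ ψ Φ F P Q)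
    (h1 : P.1 ≤ P'.1) (h2 : P.2 ≤ P'.2) (h3 : Q'.1 ≤ Q.1) (h4 : Q'.2 ≤ Q.2)
    (h5 : P'.1 < Q'.1) (h6 : P'.2 < Q'.2)
    (hP : SignNode φ ψ Φ P') (hQ : SignNode φ ψ Φ Q') : SignStep φ ψ Φ F P' Q' where
  fst_lt := h5
  snd_lt := h6
  left := hP
  right := hQ
  sign q hq := by
    obtain ⟨s, hs, hx, hx'⟩ := h.sign q hq
    exact ⟨s, hs, fun x a b => hx x (h1.trans_lt a) (b.trans_le h3),
      fun x a b => hx' x (h2.trans_lt a) (b.trans_le h4)⟩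

variable [IsStrictOrderedRing R] [IsStrictOrderedRing R₂]

theorem SignStep.refine [CharZero k] [DecidableEq k[X]] (hR : PolyIVT R) (hR' : PolyIVT R₂)
    (hφψ : ∀ a, SignType.sign (φ a) = SignType.sign (ψ a)) {p : k[X]} (hp : p ∈ Φ)
    (hder : derivative p ∈ Φ) (hmod : p ≠ 0 → ∀ q ∈ Φ, q % p ∈ Φ)
    (hF : ∀ q ∈ Φ, q.degree < p.degree → q ∈ F) {P Q : R × R₂}
    (h : SignStep φ ψ Φ F P Q) :
    Relation.TransGen (SignStep φ ψ Φ (insert p F)) P Q := by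
  by_cases hp' : derivative p = 0
  · rw [eq_C_of_natDegree_eq_zero (derivative_eq_zero.1 hp')] at *
    refine .single (h.insert_of_sign (s := SignType.sign (φ (p.coeff 0))) (fun h0 => ?_)
      (fun x _ _ => by simp) fun x _ _ => by simp [hφψ])
    simpa using h0
  have hp0 : p ≠ 0 := by rintro rfl; simp at hp'
  obtain ⟨s, hs, hs1, hs2⟩ := h.sign _ (hF _ hder (degree_derivative_lt hp0))
  have hl := h.left p hp
  have hr := h.right p hp
  simp only [← Polynomial.eval_map, ← derivative_map] at hl hr hs1 hs2
  rcases hR.sign_transfer hR' h.fst_lt h.snd_lt (hs hp') hs1 hs2 hl hr with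
    ⟨t, ht, h1, h2⟩ | ⟨t, ht, c, c', hc1, hc2, hc1', hc2', h1, h2⟩
  · simp only [Polynomial.eval_map] at h1 h2
    exact .single (h.insert_of_sign (fun _ => ht) h1 h2)
  simp only [Polynomial.eval_map] at h1 h2
  have hc : p.eval₂ φ c = 0 := by simpa using h1 c hc1 hc2
  have hc' : p.eval₂ ψ c' = 0 := by simpa using h2 c' hc1' hc2'
  have hnode : SignNode φ ψ Φ (c, c') := by
    intro q hq
    obtain ⟨u, -, hu, hu'⟩ := h.sign _ (hF _ (hmod hp0 q hq) (degree_mod_lt q hp0))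
    have e1 : q.eval₂ φ c = (q % p).eval₂ φ c := by
      conv_lhs => rw [← EuclideanDomain.div_add_mod q p]
      simp [hc]
    have e2 : q.eval₂ ψ c' = (q % p).eval₂ ψ c' := by
      conv_lhs => rw [← EuclideanDomain.div_add_mod q p]
      simp [hc']
    simp only [e1, e2, hu c hc1 hc2, hu' c' hc1' hc2']
  have s1 : SignStep φ ψ Φ F P (c, c') :=
    h.mono le_rfl le_rfl hc2.le hc2'.le hc1 hc1' h.left hnode
  have s2 : SignStep φ ψ Φ F (c, c') Q :=
    h.mono hc1.le hc1'.le le_rfl le_rfl hc2 hc2' hnode h.right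
  refine .tail (.single (s1.insert_of_sign (s := -t) (fun _ => by simpa using ht) ?_ ?_))
    (s2.insert_of_sign (s := t) (fun _ => ht) ?_ ?_)
  · intro x ha hb
    rw [h1 x ha (hb.trans hc2), sign_neg (sub_neg.2 hb)]
    simp
  · intro x ha hb
    rw [h2 x ha (hb.trans hc2'), sign_neg (sub_neg.2 hb)]
    simp
  · intro x ha hb
    rw [h1 x (hc1.trans ha) hb, sign_pos (sub_pos.2 ha)]
    simp
  · intro x ha hb
    rw [h2 x (hc1'.trans ha) hb, sign_pos (sub_pos.2 ha)]
    simp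

theorem SignStep.transGen_of_closed [CharZero k] [DecidableEq k[X]] (hR : PolyIVT R)
    (hR' : PolyIVT R₂)
    (hφψ : ∀ a, SignType.sign (φ a) = SignType.sign (ψ a))
    (hder : ∀ q ∈ Φ, derivative q ∈ Φ) (hmod : ∀ q ∈ Φ, ∀ p ∈ Φ, p ≠ 0 → q % p ∈ Φ)
    {P Q : R × R₂} (h : SignStep φ ψ Φ ∅ P Q) :
    Relation.TransGen (SignStep φ ψ Φ Φ) P Q := by
  suffices H : ∀ F : Finset k[X], F ⊆ Φ → (∀ q ∈ Φ, ∀ r ∈ F, q.degree < r.degree → q ∈ F) →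
      Relation.TransGen (SignStep φ ψ Φ F) P Q from H Φ subset_rfl fun q hq _ _ _ => hq
  intro F
  induction F using Finset.induction_on_max_value (fun q : k[X] => q.degree) with
  | empty => exact fun _ _ => .single h
  | insert p F hpF hmax ih =>
    intro hsub hdown
    have hp : p ∈ Φ := hsub (Finset.mem_insert_self _ _)
    have hlow : ∀ r, r.degree ≤ p.degree → r ∈ insert p F →
        ∀ q ∈ Φ, q.degree < r.degree → q ∈ F := by
      intro r hr hrF q hq hlt
      rcases Finset.mem_insert.1 (hdown q hq r hrF hlt) with rfl | h
      · exact (hlt.not_ge hr).elim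
      · exact h
    have := ih ((Finset.subset_insert _ _).trans hsub) fun q hq r hr hlt =>
      hlow r (hmax r hr) (Finset.mem_insert_of_mem hr) q hq hlt
    refine Relation.TransGen.trans_induction_on this (fun hs => ?_) (fun _ _ h1 h2 => h1.trans h2)
    exact hs.refine hR hR' hφψ hp (hder p hp) (fun hp0 q hq => hmod q hq p hp hp0)
      (hlow p le_rfl (Finset.mem_insert_self _ _))

omit [IsStrictOrderedRing R] in
theorem SignStep.exists_signNode {P Q : R × R₂}
    (h : Relation.TransGen (SignStep φ ψ Φ Φ) P Q) {x : R} (hP : P.1 ≤ x) (hQ : x ≤ Q.1) :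
    ∃ x', SignNode φ ψ Φ (x, x') := by
  induction h using Relation.TransGen.trans_induction_on generalizing x with
  | @single P Q h =>
    rcases hP.eq_or_lt with rfl | hP
    · exact ⟨P.2, h.left⟩
    rcases hQ.eq_or_lt with rfl | hQ
    · exact ⟨Q.2, h.right⟩
    obtain ⟨x', h1, h2⟩ := exists_between h.snd_lt
    refine ⟨x', fun q hq => ?_⟩
    obtain ⟨s, -, hs, hs'⟩ := h.sign q hq
    simp only [hs x hP hQ, hs' x' h1 h2]
  | @trans P Q S _ _ ih1 ih2 =>
    rcases le_total x Q.1 with h | h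
    · exact ih1 hP h
    · exact ih2 h hQ

/-- Sign conditions in one variable over a field `k` that are realised in a field extension with
the intermediate value property are realised in any other one inducing the same order on `k`. -/
theorem PolyIVT.exists_sign_eq (hR : PolyIVT R) (hR' : PolyIVT R₂) (φ : k →+* R) (ψ : k →+* R₂)
    (hφψ : ∀ a, SignType.sign (φ a) = SignType.sign (ψ a)) (F : Finset k[X]) (x : R) :
    ∃ x', ∀ q ∈ F, SignType.sign (q.eval₂ φ x) = SignType.sign (q.eval₂ ψ x') := by
  classical
  have : CharZero k := φ.charZero
  obtain ⟨Φ, hF, -, hder, hmod⟩ := exists_finset_closed (F.sup natDegree + 1) ∅ F fun q hq =>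
    degree_le_natDegree.trans_lt (by
      exact_mod_cast Nat.lt_succ_of_le (Finset.le_sup (f := natDegree) hq))
  obtain ⟨M, hM⟩ := exists_forall_sign_eval₂ φ Φ
  obtain ⟨M', hM'⟩ := exists_forall_sign_eval₂ ψ Φ
  suffices ∃ x', SignNode φ ψ Φ (x, x') from
    this.imp fun x' h q hq => h q (hF hq)
  have hpos : ∀ y y', M ≤ y → M' ≤ y' → SignNode φ ψ Φ (y, y') := fun y y' hy hy' q hq => by
    rw [(hM q hq y hy).1, (hM' q hq y' hy').1, hφψ]
  have hneg : ∀ y y', M ≤ y → M' ≤ y' → SignNode φ ψ Φ (-y, -y') := fun y y' hy hy' q hq => by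
    rw [(hM q hq y hy).2, (hM' q hq y' hy').2, hφψ]
  set N := max (max M 1) |x|
  have hx : |x| ≤ N := le_max_right _ _
  have hN : M ≤ N := (le_max_left _ _).trans (le_max_left _ _)
  have hN1 : 1 ≤ N := (le_max_right _ _).trans (le_max_left _ _)
  have hN1' : 1 ≤ max M' 1 := le_max_right _ _
  have hstep : SignStep φ ψ Φ ∅ (-N, -(max M' 1)) (N, max M' 1) :=
    ⟨by simp only; linarith, by simp only; linarith, hneg _ _ hN (le_max_left _ _),
      hpos _ _ hN (le_max_left _ _), by simp⟩
  exact SignStep.exists_signNode (hstep.transGen_of_closed hR hR' hφψ hder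
    fun q hq p hp => hmod q (by simpa using hq) p hp) (abs_le.1 hx).1 (abs_le.1 hx).2

end SignedStep

section Ordering

universe u

namespace RingPreordering

variable {A : Type*} [CommRing A]

theorem neg_one_mem_adjoin_of_isMax {P : RingPreordering A} (hP : IsMax P) {a : A} (ha : a ∉ P) :
    ∃ s ∈ P, ∃ t ∈ P, -1 = s + a * t := by
  by_contra hne
  let Q : RingPreordering A := RingPreordering.mk' {x | ∃ s ∈ P, ∃ t ∈ P, x = s + a * t}
    (by
      rintro x y ⟨s, hs, t, ht, rfl⟩ ⟨u, hu, v, hv, rfl⟩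
      exact ⟨s + u, add_mem hs hu, t + v, add_mem ht hv, by ring⟩)
    (by
      rintro x y ⟨s, hs, t, ht, rfl⟩ ⟨u, hu, v, hv, rfl⟩
      exact ⟨s * u + a * a * (t * v),
        add_mem (mul_mem hs hu) (mul_mem (P.mul_self_mem a) (mul_mem ht hv)),
        s * v + t * u, add_mem (mul_mem hs hv) (mul_mem ht hu), by ring⟩)
    (fun x => ⟨x * x, P.mul_self_mem x, 0, zero_mem _, by ring⟩)
    hne
  have hPQ : P ≤ Q := fun x hx => ⟨x, hx, 0, zero_mem _, by ring⟩
  exact ha (hP hPQ ⟨0, zero_mem _, 1, one_mem _, by ring⟩)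

theorem IsOrdering.of_isMax {P : RingPreordering A} (hP : IsMax P) : P.IsOrdering := by
  refine isOrdering_iff.2 fun a b hab => ?_
  by_contra! h
  obtain ⟨s, hs, t, ht, hst⟩ := neg_one_mem_adjoin_of_isMax hP h.1
  obtain ⟨u, hu, v, hv, huv⟩ := neg_one_mem_adjoin_of_isMax hP h.2
  refine P.neg_one_notMem ?_
  have : (-1 : A) = s + u + s * u + -(a * b) * (t * v) := by
    linear_combination (-b * v) * hst + (1 + s) * huv
  rw [this]
  exact add_mem (add_mem (add_mem hs hu) (mul_mem hs hu)) (mul_mem hab (mul_mem ht hv))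

theorem exists_le_isOrdering (P : RingPreordering A) : ∃ O, P ≤ O ∧ O.IsOrdering := by
  suffices ∃ O, P ≤ O ∧ IsMax O from this.imp fun O h => ⟨h.1, .of_isMax h.2⟩
  refine zorn_le_nonempty_Ici₀ P (fun c _ hc y hy => ?_) P le_rfl
  refine ⟨RingPreordering.mk' {x | ∃ Q ∈ c, x ∈ Q} ?_ ?_ (fun x => ⟨y, hy, y.mul_self_mem x⟩)
    (fun ⟨Q, _, h⟩ => Q.neg_one_notMem h), fun Q hQ x hx => ⟨Q, hQ, hx⟩⟩
  all_goals
    rintro x z ⟨Q, hQ, hx⟩ ⟨Q', hQ', hz⟩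
    rcases hc.total hQ hQ' with h | h
  · exact ⟨Q', hQ', add_mem (h hx) hz⟩
  · exact ⟨Q, hQ, add_mem hx (h hz)⟩
  · exact ⟨Q', hQ', mul_mem (h hx) hz⟩
  · exact ⟨Q, hQ, mul_mem hx (h hz)⟩

/-- A preordering of a field is nonnegative for some linear order on the field. -/
theorem exists_linearOrder {K : Type*} [Field K] (P : RingPreordering K) :
    ∃ _ : LinearOrder K, IsStrictOrderedRing K ∧ ∀ x ∈ P, 0 ≤ x := by
  classical
  obtain ⟨O, hPO, hO⟩ := P.exists_le_isOrdering
  let C : RingCone K :=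
    { O.toSubsemiring with
      eq_zero_of_mem_of_neg_mem' := fun h h' =>
        RingPreordering.eq_zero_of_mem_of_neg_mem (P := O) h h' }
  have : HasMemOrNegMem C := ⟨fun x => mem_or_neg_mem O x⟩
  let : LinearOrder K := .mkOfAddGroupCone C
  have : IsOrderedRing K := .mkOfCone C
  exact ⟨inferInstance, IsOrderedRing.toIsStrictOrderedRing K, fun x hx => by
    change x - 0 ∈ O
    rw [sub_zero]
    exact hPO hx⟩

theorem exists_ringHom_field {A : Type u} [CommRing A] (P : RingPreordering A) :
    ∃ (K : Type u) (_ : Field K) (_ : LinearOrder K) (_ : IsStrictOrderedRing K) (φ : A →+* K),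
      ∀ x ∈ P, 0 ≤ φ x := by
  obtain ⟨O, hPO, hO⟩ := P.exists_le_isOrdering
  set φ := algebraMap A O.support.ResidueField
  have hφ : ∀ a, φ a = 0 ↔ a ∈ O.support := fun a => Ideal.algebraMap_residueField_eq_zero
  have hfrac : ∀ x : O.support.ResidueField, ∃ a b, φ b ≠ 0 ∧ x * φ b = φ a := by
    intro x
    obtain ⟨a, b, hb, hx⟩ := IsFractionRing.div_surjective (A := A ⧸ O.support) x
    obtain ⟨a, rfl⟩ := Ideal.Quotient.mk_surjective a
    obtain ⟨b, rfl⟩ := Ideal.Quotient.mk_surjective b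
    have hb' : φ b ≠ 0 := by
      rw [Ne, hφ, ← Ideal.Quotient.eq_zero_iff_mem]
      exact nonZeroDivisors.ne_zero hb
    refine ⟨a, b, hb', ?_⟩
    rw [← hx]
    exact div_mul_cancel₀ _ hb'
  let Q : RingPreordering O.support.ResidueField :=
    RingPreordering.mk' {x | ∃ a ∈ O, ∃ b, φ b ≠ 0 ∧ x * φ b ^ 2 = φ a}
    (by
      rintro x y ⟨a, ha, b, hb, hx⟩ ⟨c, hc, d, hd, hy⟩
      refine ⟨a * d ^ 2 + c * b ^ 2, add_mem (mul_mem ha (O.pow_two_mem d))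
        (mul_mem hc (O.pow_two_mem b)), b * d, by simp [hb, hd], ?_⟩
      simp only [map_mul, map_add, map_pow, ← hx, ← hy]
      ring)
    (by
      rintro x y ⟨a, ha, b, hb, hx⟩ ⟨c, hc, d, hd, hy⟩
      refine ⟨a * c, mul_mem ha hc, b * d, by simp [hb, hd], ?_⟩
      simp only [map_mul, ← hx, ← hy]
      ring)
    (by
      intro x
      obtain ⟨a, b, hb, hx⟩ := hfrac x
      refine ⟨a ^ 2, O.pow_two_mem a, b, hb, ?_⟩
      rw [map_pow, ← hx]
      ring)
    (by
      rintro ⟨a, ha, b, hb, h⟩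
      have h1 : a + b ^ 2 ∈ O.support := by
        rw [← hφ, map_add, map_pow, ← h]
        ring
      have h2 : b ^ 2 ∈ O.support := by
        refine mem_support.2 ⟨O.pow_two_mem b, ?_⟩
        have := add_mem (mem_support.1 h1).2 ha
        rwa [show -(a + b ^ 2) + a = -b ^ 2 by ring] at this
      rw [← hφ, map_pow] at h2
      exact hb (pow_eq_zero_iff two_ne_zero |>.1 h2))
  obtain ⟨_, hK, hQ⟩ := Q.exists_linearOrder
  exact ⟨_, _, _, hK, φ, fun x hx => hQ _ ⟨x, hPO hx, 1, by simp, by simp⟩⟩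

end RingPreordering

end Ordering

section RealClosure

universe u

open Polynomial

/-- The sums of terms `c * g ^ 2` with `0 ≤ c` a scalar and `g ∈ S`. -/
def weightedSquares (K : Type*) {A : Type*} [CommSemiring K] [LE K] [CommSemiring A] [Algebra K A]
    (S : Set A) : AddSubmonoid A :=
  AddSubmonoid.closure {x | ∃ c : K, 0 ≤ c ∧ ∃ g ∈ S, x = c • g ^ 2}

section OrderedField

variable {F : Type*} [Field F] [LinearOrder F] [IsStrictOrderedRing F]

theorem eval_nonneg_of_mem_weightedSquares {s : F[X]} (hs : s ∈ weightedSquares F Set.univ)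
    (x : F) : 0 ≤ s.eval x := by
  induction hs using AddSubmonoid.closure_induction with
  | mem y hy =>
    obtain ⟨c, hc, g, -, rfl⟩ := hy
    simp only [Polynomial.eval_smul, Polynomial.eval_pow, smul_eq_mul]
    positivity
  | zero => simp
  | add y z _ _ hy hz => simpa using add_nonneg hy hz

omit [IsStrictOrderedRing F] in
theorem exists_mem_weightedSquares_natDegree_le {s q : F[X]}
    (hs : s ∈ weightedSquares F Set.univ) (hq : q.natDegree ≠ 0) :
    ∃ t ∈ weightedSquares F (Set.univ : Set F[X]),
      q ∣ s - t ∧ t.natDegree ≤ 2 * (q.natDegree - 1) := by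
  have hmod : ∀ g, q ∣ g - g % q := fun g =>
    ⟨g / q, by rw [sub_eq_iff_eq_add, EuclideanDomain.div_add_mod]⟩
  induction hs using AddSubmonoid.closure_induction with
  | mem y hy =>
    obtain ⟨c, hc, g, -, rfl⟩ := hy
    refine ⟨c • (g % q) ^ 2, AddSubmonoid.subset_closure ⟨c, hc, _, trivial, rfl⟩, ?_, ?_⟩
    · rw [← smul_sub, sq_sub_sq]
      exact dvd_smul_of_dvd _ ((hmod g).mul_left _)
    · refine (natDegree_smul_le _ _).trans (natDegree_pow_le.trans ?_)
      have := natDegree_mod_lt g hq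
      omega
  | zero => exact ⟨0, zero_mem _, by simp, by simp⟩
  | add y z _ _ hy hz =>
    obtain ⟨t, ht, h1, h2⟩ := hy
    obtain ⟨u, hu, h3, h4⟩ := hz
    refine ⟨t + u, add_mem ht hu, ?_, (natDegree_add_le _ _).trans (max_le h2 h4)⟩
    rw [add_sub_add_comm]
    exact dvd_add h1 h3

theorem exists_irreducible_dvd_of_eval_mul_eval_neg {f : F[X]} {a b : F}
    (hf : f.eval a * f.eval b < 0) :
    ∃ r, Irreducible r ∧ r ∣ f ∧ r.eval a * r.eval b < 0 := by
  induction f using WfDvdMonoid.induction_on_irreducible with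
  | zero => simp at hf
  | unit u hu =>
    obtain ⟨c, -, rfl⟩ := Polynomial.isUnit_iff.1 hu
    simp only [Polynomial.eval_C] at hf
    nlinarith [mul_self_nonneg c]
  | mul f i _ hi ih =>
    rcases lt_or_ge (i.eval a * i.eval b) 0 with h | h
    · exact ⟨i, hi, dvd_mul_right _ _, h⟩
    · have : f.eval a * f.eval b < 0 := by
        by_contra! h'
        simp only [Polynomial.eval_mul] at hf
        nlinarith [mul_nonneg h h']
      obtain ⟨r, hr, hrf, hs⟩ := ih this
      exact ⟨r, hr, hrf.mul_left _, hs⟩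

theorem Irreducible.not_dvd_one_add_of_eval_mul_eval_neg {q : F[X]} (hq : Irreducible q) {a b : F}
    (hab : q.eval a * q.eval b < 0) {s : F[X]} (hs : s ∈ weightedSquares F Set.univ) :
    ¬ q ∣ 1 + s := by
  induction hn : q.natDegree using Nat.strong_induction_on generalizing q s with
  | _ n ih =>
    intro hdvd
    have hq0 : q.natDegree ≠ 0 := hq.natDegree_pos.ne'
    obtain ⟨t, ht, hst, hdeg⟩ := exists_mem_weightedSquares_natDegree_le hs hq0
    obtain ⟨h, hh⟩ : q ∣ 1 + t := by
      have := dvd_sub hdvd hst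
      rwa [show 1 + s - (s - t) = 1 + t by ring] at this
    have key : ∀ x, 0 < q.eval x * h.eval x := fun x => by
      rw [← Polynomial.eval_mul, ← hh, Polynomial.eval_add, Polynomial.eval_one]
      linarith [eval_nonneg_of_mem_weightedSquares ht x]
    have hlt : h.eval a * h.eval b < 0 := by
      by_contra! hge
      nlinarith [mul_pos (key a) (key b), mul_nonneg hge (neg_nonneg.2 hab.le)]
    have hh0 : h ≠ 0 := by rintro rfl; simp at hlt
    have hdegh : h.natDegree < n := by
      have h1 : (1 + t).natDegree ≤ 2 * (q.natDegree - 1) :=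
        (natDegree_add_le _ _).trans (max_le (by simp) hdeg)
      rw [hh, natDegree_mul hq.ne_zero hh0] at h1
      omega
    obtain ⟨r, hr, hrh, hrab⟩ := exists_irreducible_dvd_of_eval_mul_eval_neg hlt
    exact ih _ ((natDegree_le_of_dvd hrh hh0).trans_lt hdegh) hr hrab ht rfl
      (hh ▸ hrh.mul_left q)

end OrderedField

section Maximal

variable {K Ω : Type*} [Field K] [LinearOrder K] [IsStrictOrderedRing K] [Field Ω] [Algebra K Ω]

theorem exists_isMax_neg_one_notMem_weightedSquares :
    ∃ F : IntermediateField K Ω, Maximal (fun F : IntermediateField K Ω =>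
      (-1 : Ω) ∉ weightedSquares K (F : Set Ω)) F := by
  refine (zorn_le_nonempty₀
    {F : IntermediateField K Ω | (-1 : Ω) ∉ weightedSquares K (F : Set Ω)}
    (fun c hc hchain y hy => ?_) ⊥ ?_).imp fun F hF => hF.2
  · refine ⟨sSup c, fun hmem => ?_, fun z hz => le_sSup hz⟩
    have : Nonempty c := ⟨⟨y, hy⟩⟩
    suffices ∀ x ∈ weightedSquares K ((sSup c : IntermediateField K Ω) : Set Ω),
        ∃ F ∈ c, x ∈ weightedSquares K (F : Set Ω) by
      obtain ⟨F, hF, h⟩ := this _ hmem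
      exact hc hF h
    have hmono : ∀ {F E : IntermediateField K Ω}, F ≤ E →
        weightedSquares K (F : Set Ω) ≤ weightedSquares K (E : Set Ω) := fun h =>
      AddSubmonoid.closure_mono fun x ⟨k, hk, g, hg, hx⟩ => ⟨k, hk, g, h hg, hx⟩
    intro x hx
    induction hx using AddSubmonoid.closure_induction with
    | mem x hx =>
      obtain ⟨k, hk, g, hg, rfl⟩ := hx
      rw [sSup_eq_iSup', IntermediateField.coe_iSup_of_directed hchain.directed] at hg
      obtain ⟨F, hF⟩ := Set.mem_iUnion.1 hg
      exact ⟨F, F.2, AddSubmonoid.subset_closure ⟨k, hk, g, hF, rfl⟩⟩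
    | zero => exact ⟨y, hy, zero_mem _⟩
    | add u v _ _ hu hv =>
      obtain ⟨E, hE, hu⟩ := hu
      obtain ⟨E', hE', hv⟩ := hv
      rcases hchain.total hE hE' with h | h
      · exact ⟨E', hE', add_mem (hmono h hu) hv⟩
      · exact ⟨E, hE, add_mem hu (hmono h hv)⟩
  · intro hmem
    suffices ∀ x ∈ weightedSquares K ((⊥ : IntermediateField K Ω) : Set Ω),
        ∃ d : K, 0 ≤ d ∧ algebraMap K Ω d = x by
      obtain ⟨d, hd, h⟩ := this _ hmem
      have : d = -1 := (algebraMap K Ω).injective (by simpa using h)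
      linarith
    intro x hx
    induction hx using AddSubmonoid.closure_induction with
    | mem x hx =>
      obtain ⟨k, hk, g, hg, rfl⟩ := hx
      obtain ⟨e, rfl⟩ := IntermediateField.mem_bot.1 hg
      exact ⟨k * e ^ 2, by positivity, by simp [Algebra.smul_def]⟩
    | zero => exact ⟨0, le_rfl, by simp⟩
    | add u v _ _ hu hv =>
      obtain ⟨d, hd, rfl⟩ := hu
      obtain ⟨e, he, rfl⟩ := hv
      exact ⟨d + e, add_nonneg hd he, by simp⟩

theorem IntermediateField.exists_linearOrder (F : IntermediateField K Ω)
    (hF : (-1 : Ω) ∉ weightedSquares K (F : Set Ω)) :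
    ∃ _ : LinearOrder F, IsStrictOrderedRing F ∧ ∀ c : K, 0 ≤ c → 0 ≤ algebraMap K F c := by
  let P : RingPreordering F :=
    RingPreordering.mk' {x | (x : Ω) ∈ weightedSquares K (F : Set Ω)}
    (fun {x y} hx hy => (weightedSquares K (F : Set Ω)).add_mem hx hy)
    (by
      intro x y hx hy
      simp only [Set.mem_ofPred_eq, MulMemClass.coe_mul] at *
      generalize (x : Ω) = x at *
      generalize (y : Ω) = y at *
      induction hx using AddSubmonoid.closure_induction with
      | mem x hx =>
        obtain ⟨c, hc, g, hg, rfl⟩ := hx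
        induction hy using AddSubmonoid.closure_induction with
        | mem y hy =>
          obtain ⟨d, hd, e, he, rfl⟩ := hy
          refine AddSubmonoid.subset_closure ⟨c * d, mul_nonneg hc hd, g * e, mul_mem hg he, ?_⟩
          rw [smul_mul_smul_comm, mul_pow]
        | zero => simp
        | add u v _ _ hu hv => rw [mul_add]; exact add_mem hu hv
      | zero => simp
      | add u v _ _ hu hv => rw [add_mul]; exact add_mem hu hv)
    (fun x => AddSubmonoid.subset_closure ⟨1, zero_le_one, x, x.2, by simp [sq]⟩)
    (by simpa using hF)
  obtain ⟨o, ho, h⟩ := P.exists_linearOrder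
  refine ⟨o, ho, fun c hc => h _ ?_⟩
  exact AddSubmonoid.subset_closure ⟨c, hc, 1, one_mem F, by simp [Algebra.smul_def]⟩

omit [IsStrictOrderedRing K] in
theorem IntermediateField.polyIVT_of_maximal [IsAlgClosed Ω] (F : IntermediateField K Ω)
    (hF : Maximal (fun F : IntermediateField K Ω =>
      (-1 : Ω) ∉ weightedSquares K (F : Set Ω)) F)
    [LinearOrder F] [IsStrictOrderedRing F] (hKF : ∀ c : K, 0 ≤ c → 0 ≤ algebraMap K F c) :
    PolyIVT F := by
  intro f a b hab hf
  obtain ⟨r, hr, hrf, hrab⟩ := exists_irreducible_dvd_of_eval_mul_eval_neg hf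
  obtain ⟨α, hα⟩ := IsAlgClosed.exists_aeval_eq_zero Ω r
    (Polynomial.degree_pos_of_irreducible hr).ne'
  have halg : IsAlgebraic F α := ⟨r, hr.ne_zero, hα⟩
  let E : IntermediateField K Ω := (IntermediateField.adjoin F {α}).restrictScalars K
  have hFE : F ≤ E := fun x hx => algebraMap_mem (IntermediateField.adjoin F {α}) (⟨x, hx⟩ : F)
  have hE : (-1 : Ω) ∉ weightedSquares K (E : Set Ω) := by
    intro hmem
    suffices ∀ x ∈ weightedSquares K (E : Set Ω),
        ∃ s ∈ weightedSquares F (Set.univ : Set F[X]), aeval α s = x by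
      obtain ⟨s, hs, h⟩ := this _ hmem
      refine hr.not_dvd_one_add_of_eval_mul_eval_neg hrab hs ?_
      have h1 : minpoly F α ∣ 1 + s := minpoly.dvd _ _ (by simp [h])
      rw [← minpoly.eq_of_irreducible hr hα] at h1
      exact (dvd_mul_right _ _).trans h1
    intro x hx
    induction hx using AddSubmonoid.closure_induction with
    | mem x hx =>
      obtain ⟨k, hk, g, hg, rfl⟩ := hx
      replace hg : g ∈ (IntermediateField.adjoin F {α}).toSubalgebra := hg
      rw [IntermediateField.adjoin_simple_toSubalgebra_of_isAlgebraic halg] at hg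
      obtain ⟨u, rfl⟩ := Algebra.adjoin_mem_exists_aeval F α hg
      refine ⟨algebraMap K F k • u ^ 2,
        AddSubmonoid.subset_closure ⟨_, hKF k hk, u, trivial, rfl⟩, ?_⟩
      rw [map_smul, map_pow, algebraMap_smul]
    | zero => exact ⟨0, zero_mem _, by simp⟩
    | add u v _ _ hu hv =>
      obtain ⟨d, hd, rfl⟩ := hu
      obtain ⟨e, he, rfl⟩ := hv
      exact ⟨d + e, add_mem hd he, by simp⟩
  have hαF : α ∈ F := hF.2 hE hFE (IntermediateField.mem_adjoin_simple_self F α)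
  have hroot : r.IsRoot ⟨α, hαF⟩ := by
    have : aeval (algebraMap F Ω ⟨α, hαF⟩) r = 0 := hα
    rw [Polynomial.aeval_algebraMap_apply, Polynomial.coe_aeval_eq_eval] at this
    exact (algebraMap F Ω).injective (this.trans (map_zero _).symm)
  have hdeg : r.degree = 1 := degree_eq_one_of_irreducible_of_root hr hroot
  rw [eq_X_add_C_of_degree_eq_one hdeg] at hroot hrab
  simp only [IsRoot, Polynomial.eval_add, Polynomial.eval_mul, Polynomial.eval_C,
    Polynomial.eval_X] at hroot hrab
  set c : F := ⟨α, hαF⟩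
  set u := r.leadingCoeff
  set v := r.coeff 0
  have hv : v = - u * c := by linear_combination hroot
  rw [hv] at hrab
  have h2 : u ^ 2 * ((a - c) * (b - c)) < 0 := by linarith
  have h3 : (a - c) * (b - c) < 0 := by
    by_contra! h
    nlinarith [mul_nonneg (sq_nonneg u) h]
  have h4 : f.eval c = 0 := by
    obtain ⟨w, rfl⟩ := hrf
    rw [Polynomial.eval_mul, eq_X_add_C_of_degree_eq_one hdeg]
    simp only [Polynomial.eval_add, Polynomial.eval_mul, Polynomial.eval_C, Polynomial.eval_X]
    rw [hroot, zero_mul]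
  rcases mul_neg_iff.1 h3 with h | h
  · linarith [h.1, h.2]
  · exact ⟨c, sub_neg.1 h.1, sub_pos.1 h.2, h4⟩

end Maximal

/-- Every ordered field embeds in an ordered field with the intermediate value property. -/
theorem exists_polyIVT_extension (K : Type u) [Field K] [LinearOrder K] [IsStrictOrderedRing K] :
    ∃ (R : Type u) (_ : Field R) (_ : LinearOrder R) (_ : IsStrictOrderedRing R) (φ : K →+* R),
      PolyIVT R ∧ ∀ c, 0 ≤ c → 0 ≤ φ c := by
  obtain ⟨F, hF⟩ := exists_isMax_neg_one_notMem_weightedSquares (K := K) (Ω := AlgebraicClosure K)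
  obtain ⟨_, ho, h⟩ := F.exists_linearOrder hF.1
  exact ⟨F, _, _, ho, algebraMap K F, F.polyIVT_of_maximal hF h, h⟩

end RealClosure

section Transfer

open Polynomial

section CommRing

variable {A R R₂ : Type*} [CommRing A] [Field R] [LinearOrder R] [IsStrictOrderedRing R]
  [Field R₂] [LinearOrder R₂] [IsStrictOrderedRing R₂]

/-- Version of `PolyIVT.exists_sign_eq` over a commutative ring of coefficients. -/
theorem PolyIVT.exists_sign_eq_of_commRing (hR : PolyIVT R) (hR' : PolyIVT R₂) (φ : A →+* R)
    (ψ : A →+* R₂) (hφψ : ∀ a, SignType.sign (φ a) = SignType.sign (ψ a)) (F : Finset A[X])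
    (x : R) :
    ∃ x', ∀ q ∈ F, SignType.sign (q.eval₂ φ x) = SignType.sign (q.eval₂ ψ x') := by
  classical
  have hker : ∀ a, ψ a = 0 ↔ φ a = 0 := fun a => by
    rw [← sign_eq_zero_iff, ← hφψ, sign_eq_zero_iff]
  set P := RingHom.ker φ
  have : P.IsPrime := RingHom.ker_isPrime φ
  let φ' : P.ResidueField →+* R := Ideal.ResidueField.lift P φ le_rfl fun a ha =>
    isUnit_iff_ne_zero.2 ha
  let ψ' : P.ResidueField →+* R₂ := Ideal.ResidueField.lift P ψ (fun a ha => (hker a).2 ha)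
    fun a ha => isUnit_iff_ne_zero.2 fun h => ha ((hker a).1 h)
  have hφa : ∀ a, φ' (algebraMap A P.ResidueField a) = φ a := fun a =>
    Ideal.ResidueField.lift_algebraMap ..
  have hψa : ∀ a, ψ' (algebraMap A P.ResidueField a) = ψ a := fun a =>
    Ideal.ResidueField.lift_algebraMap ..
  have hφ' : φ'.comp (algebraMap A P.ResidueField) = φ := RingHom.ext hφa
  have hψ' : ψ'.comp (algebraMap A P.ResidueField) = ψ := RingHom.ext hψa
  have hsign : ∀ z, SignType.sign (φ' z) = SignType.sign (ψ' z) := by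
    intro z
    obtain ⟨a, b, hb, rfl⟩ := IsFractionRing.div_surjective (A := A ⧸ P) z
    obtain ⟨a, rfl⟩ := Ideal.Quotient.mk_surjective a
    obtain ⟨b, rfl⟩ := Ideal.Quotient.mk_surjective b
    have hb' : φ b ≠ 0 := fun h => nonZeroDivisors.ne_zero hb (Ideal.Quotient.eq_zero_iff_mem.2 h)
    have hb'' : ψ b ≠ 0 := fun h => hb' ((hker b).1 h)
    set z := algebraMap (A ⧸ P) P.ResidueField (Ideal.Quotient.mk P a) /
      algebraMap (A ⧸ P) P.ResidueField (Ideal.Quotient.mk P b)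
    have hz : z * algebraMap A P.ResidueField b ^ 2 = algebraMap A P.ResidueField (a * b) := by
      have : z * algebraMap A P.ResidueField b = algebraMap A P.ResidueField a :=
        div_mul_cancel₀ _ fun h => hb' (by rw [← hφa]; exact (congrArg φ' h).trans (map_zero _))
      rw [sq, ← mul_assoc, this, map_mul]
    have h1 := congrArg φ' hz
    have h2 := congrArg ψ' hz
    rw [map_mul, map_pow, hφa, hφa] at h1
    rw [map_mul, map_pow, hψa, hψa] at h2
    have h3 := hφψ (a * b)
    rwa [← h1, ← h2, sign_mul, sign_mul, sign_pos (by positivity : 0 < φ b ^ 2),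
      sign_pos (by positivity : 0 < ψ b ^ 2), mul_one, mul_one] at h3
  obtain ⟨x', hx'⟩ := hR.exists_sign_eq hR' φ' ψ' hsign
    (F.image (Polynomial.map (algebraMap A P.ResidueField))) x
  refine ⟨x', fun q hq => ?_⟩
  have := hx' _ (Finset.mem_image_of_mem _ hq)
  rwa [Polynomial.eval₂_map, Polynomial.eval₂_map, hφ', hψ'] at this

end CommRing

end Transfer

section Ultrapower

universe u

open Polynomial Filter

variable {ι R₂ : Type*} [Field R₂] [LinearOrder R₂] {U : Ultrafilter ι}

theorem Filter.Germ.sign_coe_eq_iff (f : ι → R₂) (s : SignType) :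
    SignType.sign (f : Germ (U : Filter ι) R₂) = s ↔ ∀ᶠ i in U, SignType.sign (f i) = s := by
  rcases s with _ | _ | _
  · change _ = 0 ↔ ∀ᶠ i in (U : Filter ι), SignType.sign (f i) = 0
    simp only [sign_eq_zero_iff]
    exact Germ.coe_eq
  · rw [show SignType.neg = -1 from rfl]
    simp only [sign_eq_neg_one_iff]
    exact Germ.coe_lt
  · change _ = 1 ↔ ∀ᶠ i in (U : Filter ι), SignType.sign (f i) = 1
    simp only [sign_eq_one_iff]
    exact Germ.coe_pos

theorem PolyIVT.germ (hR' : PolyIVT R₂) : PolyIVT (Germ (U : Filter ι) R₂) := by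
  intro f a b hab hf
  obtain ⟨g, rfl⟩ := Polynomial.map_surjective (Germ.coeRingHom (U : Filter ι))
    Quotient.mk_surjective f
  induction a using Germ.inductionOn with | _ a
  induction b using Germ.inductionOn with | _ b
  have heval : ∀ c : ι → R₂, (g.map (Germ.coeRingHom (U : Filter ι))).eval
      (c : Germ (U : Filter ι) R₂) = ((g.eval c : ι → R₂) : Germ (U : Filter ι) R₂) := fun c =>
    Polynomial.eval_map_apply (f := Germ.coeRingHom (U : Filter ι)) (p := g) c
  have hpt : ∀ (c : ι → R₂) (j : ι),
      (g.map (Pi.evalRingHom (fun _ => R₂) j)).eval (c j) = (g.eval c) j := fun c j =>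
    Polynomial.eval_map_apply (f := Pi.evalRingHom (fun _ => R₂) j) (p := g) c
  rw [heval, heval, ← Germ.coe_mul] at hf
  have h1 : ∀ᶠ j in U, a j < b j := Germ.coe_lt.1 hab
  have h2 : ∀ᶠ j in U, (g.eval a * g.eval b) j < 0 := Germ.coe_lt.1 hf
  have h3 : ∀ j, ∃ c, a j < b j ∧ (g.eval a * g.eval b) j < 0 →
      a j < c ∧ c < b j ∧ (g.map (Pi.evalRingHom (fun _ => R₂) j)).eval c = 0 := by
    intro j
    by_cases h : a j < b j ∧ (g.eval a * g.eval b) j < 0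
    · obtain ⟨c, hc⟩ := hR' (g.map (Pi.evalRingHom (fun _ => R₂) j)) _ _ h.1
        (by rw [hpt, hpt]; exact h.2)
      exact ⟨c, fun _ => hc⟩
    · exact ⟨0, fun h' => (h h').elim⟩
  choose c hc using h3
  refine ⟨(c : Germ (U : Filter ι) R₂), Germ.coe_lt.2 ?_, Germ.coe_lt.2 ?_, ?_⟩
  · filter_upwards [h1, h2] with j h1 h2 using (hc j ⟨h1, h2⟩).1
  · filter_upwards [h1, h2] with j h1 h2 using (hc j ⟨h1, h2⟩).2.1
  · rw [heval]
    refine Germ.coe_eq.2 ?_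
    filter_upwards [h1, h2] with j h1 h2
    rw [← hpt]
    exact (hc j ⟨h1, h2⟩).2.2

variable (U R₂) in
/-- The diagonal embedding of a field in its ultrapower. -/
noncomputable def Filter.Germ.diag : R₂ →+* Germ (U : Filter ι) R₂ :=
  (Germ.coeRingHom (U : Filter ι)).comp (Pi.constRingHom ι R₂)

omit [LinearOrder R₂] in
theorem Filter.Germ.eval₂_diag {A : Type*} [CommRing A] (ψ : A →+* R₂) (c : ι → R₂) (q : A[X]) :
    q.eval₂ ((Germ.diag R₂ U).comp ψ) (c : Germ (U : Filter ι) R₂) =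
      ((fun j => q.eval₂ ψ (c j) : ι → R₂) : Germ (U : Filter ι) R₂) := by
  have h1 := Polynomial.hom_eval₂ q ((Pi.constRingHom ι R₂).comp ψ)
    (Germ.coeRingHom (U : Filter ι)) c
  refine h1.symm.trans (congrArg (Germ.ofFun (l := (U : Filter ι))) (funext fun j => ?_))
  exact Polynomial.hom_eval₂ q ((Pi.constRingHom ι R₂).comp ψ) (Pi.evalRingHom (fun _ => R₂) j) c

omit [LinearOrder R₂] in
theorem Filter.Germ.mvPolynomial_eval₂_diag {A σ : Type*} [CommRing A] (ψ : A →+* R₂)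
    (c : σ → ι → R₂) (q : MvPolynomial σ A) :
    MvPolynomial.eval₂ ((Germ.diag R₂ U).comp ψ) (fun i => (c i : Germ (U : Filter ι) R₂)) q =
      ((fun j => MvPolynomial.eval₂ ψ (fun i => c i j) q : ι → R₂) :
        Germ (U : Filter ι) R₂) := by
  have h1 := MvPolynomial.eval₂_comp_left (Germ.coeRingHom (U : Filter ι))
    ((Pi.constRingHom ι R₂).comp ψ) c q
  refine h1.symm.trans (congrArg (Germ.ofFun (l := (U : Filter ι))) (funext fun j => ?_))
  exact MvPolynomial.eval₂_comp_left (Pi.evalRingHom (fun _ => R₂) j)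
    ((Pi.constRingHom ι R₂).comp ψ) c q

/-- Sign conditions realised in an ultrapower are realised in the base field. -/
theorem exists_sign_eq_of_germ {A σ : Type*} [CommRing A] (ψ : A →+* R₂)
    (F : Finset (MvPolynomial σ A)) (s : MvPolynomial σ A → SignType)
    (t : σ → Germ (U : Filter ι) R₂)
    (ht : ∀ q ∈ F, s q = SignType.sign (MvPolynomial.eval₂ ((Germ.diag R₂ U).comp ψ) t q)) :
    ∃ x : σ → R₂, ∀ q ∈ F, s q = SignType.sign (MvPolynomial.eval₂ ψ x q) := by
  have : ∀ i, ∃ c : ι → R₂, (c : Germ (U : Filter ι) R₂) = t i :=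
    fun i => Quotient.mk_surjective (t i)
  choose c hc using this
  obtain rfl : (fun i => (c i : Germ (U : Filter ι) R₂)) = t := funext hc
  have hev : ∀ᶠ j in U, ∀ q ∈ F, s q = SignType.sign (MvPolynomial.eval₂ ψ (fun i => c i j) q) := by
    refine (Filter.eventually_all_finset F).2 fun q hq => ?_
    have := ht q hq
    rw [Germ.mvPolynomial_eval₂_diag, eq_comm, Germ.sign_coe_eq_iff] at this
    exact this.mono fun _ => Eq.symm
  obtain ⟨j, hj⟩ := hev.exists
  exact ⟨_, hj⟩

/-- A point realises in an ultrapower of another field all its sign conditions at once. -/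
theorem PolyIVT.exists_germ_sign_eq {A : Type u} [CommRing A] {R : Type*} [Field R] [LinearOrder R]
    [IsStrictOrderedRing R] [IsStrictOrderedRing R₂] (hR : PolyIVT R) (hR' : PolyIVT R₂)
    (φ : A →+* R) (ψ : A →+* R₂)
    (hφψ : ∀ a, SignType.sign (φ a) = SignType.sign (ψ a)) (x : R) :
    ∃ (ι : Type u) (U : Ultrafilter ι) (t : Germ (U : Filter ι) R₂), ∀ q : A[X],
      SignType.sign (q.eval₂ φ x) = SignType.sign (q.eval₂ ((Germ.diag R₂ U).comp ψ) t) := by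
  classical
  choose c hc using fun F : Finset A[X] => hR.exists_sign_eq_of_commRing hR' φ ψ hφψ F x
  refine ⟨Finset A[X], Ultrafilter.of atTop, (c : Germ _ R₂), fun q => ?_⟩
  rw [Germ.eval₂_diag, eq_comm, Germ.sign_coe_eq_iff]
  refine Ultrafilter.of_le atTop ?_
  filter_upwards [eventually_ge_atTop {q}] with F hF
  exact (hc F q (hF (Finset.mem_singleton_self q))).symm

end Ultrapower

section Multivariate

universe u

theorem MvPolynomial.eval₂_optionEquivRight {k R σ : Type*} [CommRing k] [CommRing R]
    (φ : k →+* R) (r : Option σ → R) (q : MvPolynomial (Option σ) k) :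
    eval₂ (Polynomial.eval₂RingHom φ (r none)) (fun i => r (some i)) (optionEquivRight k σ q) =
      eval₂ φ r q := by
  induction q using MvPolynomial.induction_on with
  | C a => simp
  | add p q hp hq => rw [map_add, eval₂_add, hp, hq, eval₂_add]
  | mul_X p i hp =>
    rw [map_mul, eval₂_mul, hp, eval₂_mul, eval₂_X]
    cases i <;> simp

/-- Transfer of multivariate sign conditions between ordered fields with the intermediate value
property inducing the same order on the coefficients. -/
theorem PolyIVT.exists_mvPolynomial_sign_eq {R : Type u} [Field R] [LinearOrder R]
    [IsStrictOrderedRing R] (hR : PolyIVT R) (σ : Type u) [Finite σ] :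
    ∀ (k R₂ : Type u) [CommRing k] [Field R₂] [LinearOrder R₂] [IsStrictOrderedRing R₂]
      (_ : PolyIVT R₂) (φ : k →+* R) (ψ : k →+* R₂)
      (_ : ∀ a, SignType.sign (φ a) = SignType.sign (ψ a)) (F : Finset (MvPolynomial σ k))
      (r : σ → R), ∃ s : σ → R₂, ∀ q ∈ F,
        SignType.sign (eval₂ φ r q) = SignType.sign (eval₂ ψ s q) := by
  classical
  induction σ using Finite.induction_empty_option with
  | of_equiv e ih =>
    intro k R₂ _ _ _ _ hR' φ ψ hφψ F r
    obtain ⟨s, hs⟩ := ih k R₂ hR' φ ψ hφψ (F.image (rename e.symm)) (r ∘ e)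
    refine ⟨s ∘ e.symm, fun q hq => ?_⟩
    have := hs _ (Finset.mem_image_of_mem _ hq)
    rw [eval₂_rename, eval₂_rename] at this
    simpa [Function.comp_assoc] using this
  | h_empty =>
    intro k R₂ _ _ _ _ hR' φ ψ hφψ F r
    refine ⟨PEmpty.elim, fun q _ => ?_⟩
    obtain ⟨a, rfl⟩ := C_surjective PEmpty q
    simp [hφψ]
  | h_option ih =>
    intro k R₂ _ _ _ _ hR' φ ψ hφψ F r
    obtain ⟨ι, U, t₀, ht₀⟩ := hR.exists_germ_sign_eq hR' φ ψ hφψ (r none)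
    obtain ⟨t, ht⟩ := ih (Polynomial k) (Filter.Germ (U : Filter ι) R₂) hR'.germ
      (Polynomial.eval₂RingHom φ (r none))
      (Polynomial.eval₂RingHom ((Filter.Germ.diag R₂ U).comp ψ) t₀) ht₀
      (F.image (optionEquivRight k _)) (fun i => r (some i))
    refine exists_sign_eq_of_germ ψ F _ (fun o : Option _ => o.elim t₀ t) fun q hq => ?_
    have := ht _ (Finset.mem_image_of_mem _ hq)
    rw [eval₂_optionEquivRight] at this
    rw [this, ← eval₂_optionEquivRight]
    rfl

end Multivariate

section Certificates

theorem IsSOS.add {σ : Type*} {p q : MvPolynomial σ ℝ} (hp : IsSOS p) (hq : IsSOS q) :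
    IsSOS (p + q) := by
  obtain ⟨m, f, rfl⟩ := hp
  obtain ⟨l, g, rfl⟩ := hq
  exact ⟨m + l, Fin.append f g, by simp [Fin.sum_univ_add]⟩

theorem IsSOS.zero {σ : Type*} : IsSOS (0 : MvPolynomial σ ℝ) := ⟨0, Fin.elim0, by simp⟩

variable {n n₁ n₃ : ℕ} (f : Fin n₁ → MvPolynomial (Fin n) ℝ)

/-- The sums of terms `g ^ 2 * m` with `m` in the monoid generated by `f`. -/
noncomputable def coneAddSubmonoid : AddSubmonoid (MvPolynomial (Fin n) ℝ) :=
  AddSubmonoid.closure {x | ∃ (g : MvPolynomial (Fin n) ℝ) (k : Fin n₁ → ℕ),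
    x = g ^ 2 * ∏ i, f i ^ k i}

variable {f}

theorem InCone.add {p q : MvPolynomial (Fin n) ℝ} (hp : InCone f p) (hq : InCone f q) :
    InCone f (p + q) := by
  classical
  obtain ⟨s₀, T, s, hs₀, hs, rfl⟩ := hp
  obtain ⟨t₀, T', t, ht₀, ht, rfl⟩ := hq
  refine ⟨s₀ + t₀, T ∪ T', fun k => (if k ∈ T then s k else 0) + (if k ∈ T' then t k else 0),
    hs₀.add ht₀, fun k _ => ?_, ?_⟩
  · refine IsSOS.add ?_ ?_
    · split_ifs with hk
      exacts [hs k hk, .zero]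
    · split_ifs with hk
      exacts [ht k hk, .zero]
  · simp only [add_mul, Finset.sum_add_distrib, ite_mul, zero_mul, Finset.sum_ite_mem,
      Finset.union_inter_cancel_left, Finset.union_inter_cancel_right]
    ring

theorem mul_prod_mem_coneAddSubmonoid {s : MvPolynomial (Fin n) ℝ} (hs : IsSOS s)
    (k : Fin n₁ → ℕ) : s * ∏ i, f i ^ k i ∈ coneAddSubmonoid f := by
  obtain ⟨m, g, rfl⟩ := hs
  rw [Finset.sum_mul]
  exact sum_mem fun j _ => AddSubmonoid.subset_closure ⟨g j, k, rfl⟩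

theorem inCone_iff_mem_coneAddSubmonoid {p : MvPolynomial (Fin n) ℝ} :
    InCone f p ↔ p ∈ coneAddSubmonoid f := by
  constructor
  · rintro ⟨s₀, T, s, hs₀, hs, rfl⟩
    refine add_mem ?_ (sum_mem fun k hk => mul_prod_mem_coneAddSubmonoid (hs k hk) k)
    simpa using mul_prod_mem_coneAddSubmonoid (f := f) hs₀ 0
  · intro hp
    induction hp using AddSubmonoid.closure_induction with
    | mem x hx =>
      obtain ⟨g, k, rfl⟩ := hx
      exact ⟨0, {k}, fun _ => g ^ 2, .zero, fun _ _ => ⟨1, fun _ => g, by simp⟩, by simp⟩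
    | zero => exact ⟨0, ∅, 0, .zero, by simp, by simp⟩
    | add u v _ _ hu hv => exact hu.add hv

theorem mul_mem_coneAddSubmonoid {p q : MvPolynomial (Fin n) ℝ} (hp : p ∈ coneAddSubmonoid f)
    (hq : q ∈ coneAddSubmonoid f) : p * q ∈ coneAddSubmonoid f := by
  induction hp using AddSubmonoid.closure_induction with
  | mem x hx =>
    obtain ⟨g, k, rfl⟩ := hx
    induction hq using AddSubmonoid.closure_induction with
    | mem y hy =>
      obtain ⟨e, l, rfl⟩ := hy
      refine AddSubmonoid.subset_closure ⟨g * e, k + l, ?_⟩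
      simp only [Pi.add_apply, pow_add, Finset.prod_mul_distrib]
      ring
    | zero => simp
    | add u v _ _ hu hv => rw [mul_add]; exact add_mem hu hv
  | zero => simp
  | add u v _ _ hu hv => rw [add_mul]; exact add_mem hu hv

theorem sq_mem_coneAddSubmonoid (g : MvPolynomial (Fin n) ℝ) : g ^ 2 ∈ coneAddSubmonoid f :=
  AddSubmonoid.subset_closure ⟨g, 0, by simp⟩

theorem generator_mem_coneAddSubmonoid (i : Fin n₁) : f i ∈ coneAddSubmonoid f :=
  AddSubmonoid.subset_closure ⟨1, Pi.single i 1, by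
    rw [Finset.prod_eq_single i (fun j _ hj => by rw [Pi.single_eq_of_ne hj, pow_zero]) (by simp)]
    simp⟩

theorem inIdeal_iff_mem_span {h : Fin n₃ → MvPolynomial (Fin n) ℝ} {H : MvPolynomial (Fin n) ℝ} :
    InIdeal h H ↔ H ∈ Ideal.span (Set.range h) := by
  rw [Ideal.mem_span_range_iff_exists_fun]
  exact exists_congr fun _ => eq_comm

theorem InCone.eval_nonneg {p : MvPolynomial (Fin n) ℝ} (hp : InCone f p) {x : Fin n → ℝ}
    (hx : ∀ i, 0 ≤ eval x (f i)) : 0 ≤ eval x p := by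
  rw [inCone_iff_mem_coneAddSubmonoid] at hp
  induction hp using AddSubmonoid.closure_induction with
  | mem y hy =>
    obtain ⟨g, k, rfl⟩ := hy
    rw [map_mul, map_pow, map_prod]
    exact mul_nonneg (sq_nonneg _) (Finset.prod_nonneg fun i _ => by
      rw [map_pow]; exact pow_nonneg (hx i) _)
  | zero => simp
  | add u v _ _ hu hv => simpa using add_nonneg hu hv

theorem exists_certificate_or_preordering (f : Fin n₁ → MvPolynomial (Fin n) ℝ)
    (h : Fin n₃ → MvPolynomial (Fin n) ℝ) (p : MvPolynomial (Fin n) ℝ) :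
    (∃ σ τ H : MvPolynomial (Fin n) ℝ,
      InCone f σ ∧ InCone f τ ∧ InIdeal h H ∧ p * σ = 1 + τ + H) ∨
    ∃ P : RingPreordering (MvPolynomial (Fin n) ℝ),
      (∀ i, f i ∈ P) ∧ (∀ j, h j ∈ P ∧ -h j ∈ P) ∧ -p ∈ P := by
  by_cases hcert : ∃ σ τ H : MvPolynomial (Fin n) ℝ,
      InCone f σ ∧ InCone f τ ∧ InIdeal h H ∧ p * σ = 1 + τ + H
  · exact .inl hcert
  refine .inr ⟨RingPreordering.mk' {x | ∃ s ∈ coneAddSubmonoid f, ∃ t ∈ coneAddSubmonoid f,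
    ∃ H ∈ Ideal.span (Set.range h), x = s - p * t + H} ?_ ?_ ?_ ?_, fun i => ?_, fun j => ?_, ?_⟩
  · rintro x y ⟨s, hs, t, ht, H, hH, rfl⟩ ⟨u, hu, v, hv, I, hI, rfl⟩
    exact ⟨s + u, add_mem hs hu, t + v, add_mem ht hv, H + I, add_mem hH hI, by ring⟩
  · rintro x y ⟨s, hs, t, ht, H, hH, rfl⟩ ⟨u, hu, v, hv, I, hI, rfl⟩
    refine ⟨s * u + p ^ 2 * (t * v), add_mem (mul_mem_coneAddSubmonoid hs hu)
      (mul_mem_coneAddSubmonoid (sq_mem_coneAddSubmonoid p) (mul_mem_coneAddSubmonoid ht hv)),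
      s * v + t * u, add_mem (mul_mem_coneAddSubmonoid hs hv) (mul_mem_coneAddSubmonoid ht hu),
      (u - p * v + I) * H + (s - p * t) * I,
      add_mem (Ideal.mul_mem_left _ _ hH) (Ideal.mul_mem_left _ _ hI), by ring⟩
  · exact fun x => ⟨x ^ 2, sq_mem_coneAddSubmonoid x, 0, zero_mem _, 0, zero_mem _, by ring⟩
  · rintro ⟨s, hs, t, ht, H, hH, heq⟩
    exact hcert ⟨t, s, H, inCone_iff_mem_coneAddSubmonoid.2 ht,
      inCone_iff_mem_coneAddSubmonoid.2 hs, inIdeal_iff_mem_span.2 hH, by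
        linear_combination heq⟩
  · exact ⟨f i, generator_mem_coneAddSubmonoid i, 0, zero_mem _, 0, zero_mem _, by ring⟩
  · have hj : h j ∈ Ideal.span (Set.range h) := Ideal.subset_span ⟨j, rfl⟩
    exact ⟨⟨0, zero_mem _, 0, zero_mem _, h j, hj, by ring⟩,
      ⟨0, zero_mem _, 0, zero_mem _, -h j, neg_mem hj, by ring⟩⟩
  · refine ⟨0, zero_mem _, 1, ?_, 0, zero_mem _, by ring⟩
    simpa using sq_mem_coneAddSubmonoid (f := f) 1

theorem polyIVT_real : PolyIVT ℝ := by
  intro f a b hab hf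
  have h0 : (0 : ℝ) ∈ Set.uIcc (f.eval a) (f.eval b) := by
    rcases mul_neg_iff.1 hf with h | h
    · exact Set.mem_uIcc.2 (.inr ⟨h.2.le, h.1.le⟩)
    · exact Set.mem_uIcc.2 (.inl ⟨h.1.le, h.2.le⟩)
  obtain ⟨c, hc, hc0⟩ := intermediate_value_uIcc f.continuous.continuousOn h0
  rw [Set.uIcc_of_le hab.le] at hc
  simp only at hc0
  refine ⟨c, lt_of_le_of_ne hc.1 ?_, lt_of_le_of_ne hc.2 ?_, hc0⟩
  · rintro rfl
    simp [hc0] at hf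
  · rintro rfl
    simp [hc0] at hf

theorem sign_map_real {R : Type*} [Field R] [LinearOrder R] [IsStrictOrderedRing R] (φ : ℝ →+* R)
    (a : ℝ) : SignType.sign (φ a) = SignType.sign a := by
  have hpos : ∀ a : ℝ, 0 < a → 0 < φ a := fun a ha => by
    rw [← Real.sq_sqrt ha.le, map_pow]
    have : φ (√a) ≠ 0 := (map_ne_zero φ).2 (Real.sqrt_pos.2 ha).ne'
    positivity
  rcases lt_trichotomy a 0 with ha | rfl | ha
  · have := hpos (-a) (neg_pos.2 ha)
    rw [map_neg, neg_pos] at this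
    rw [sign_neg ha, sign_neg this]
  · simp
  · rw [sign_pos ha, sign_pos (hpos a ha)]

/-- A preordering of the real polynomial ring is nonnegative at points approximating it on any
finite set. -/
theorem RingPreordering.exists_eval_nonneg {σ : Type} [Finite σ]
    (P : RingPreordering (MvPolynomial σ ℝ)) (F : Finset (MvPolynomial σ ℝ)) :
    ∃ x : σ → ℝ, ∀ q ∈ F, q ∈ P → 0 ≤ eval x q := by
  obtain ⟨K, _, _, _, φ, hφ⟩ := P.exists_ringHom_field
  obtain ⟨R, _, _, _, χ, hR, hχ⟩ := exists_polyIVT_extension K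
  let Φ : MvPolynomial σ ℝ →+* R := χ.comp φ
  obtain ⟨x, hx⟩ := hR.exists_mvPolynomial_sign_eq σ ℝ ℝ polyIVT_real (Φ.comp C) (RingHom.id ℝ)
    (sign_map_real _) F fun i => Φ (X i)
  have hΦ : eval₂Hom (Φ.comp C) (fun i => Φ (X i)) = Φ := by
    ext <;> simp
  refine ⟨x, fun q hq hqP => ?_⟩
  have h1 : SignType.sign (Φ q) = SignType.sign (eval x q) := by
    have := hx q hq
    rwa [← coe_eval₂Hom, hΦ] at this
  rw [← sign_nonneg_iff, ← h1, sign_nonneg_iff]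
  exact hχ _ (hφ q hqP)

end Certificates

/-- **Stengle's Corollary.** Let `S = {x : fᵢ(x) ≥ 0, hⱼ(x) = 0}`. Then `p > 0` on `S`
if and only if there exist `σ, τ` in the cone generated by the `fᵢ` and `h` in the ideal
generated by the `hⱼ` such that `p·σ = 1 + τ + h`. -/
theorem stengle_corollary {n n₁ n₃ : ℕ}
    (f : Fin n₁ → MvPolynomial (Fin n) ℝ) (h : Fin n₃ → MvPolynomial (Fin n) ℝ)
    (p : MvPolynomial (Fin n) ℝ) :
    (∀ x ∈ {x : Fin n → ℝ | (∀ i, 0 ≤ eval x (f i)) ∧ ∀ j, eval x (h j) = 0},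
        0 < eval x p) ↔
      ∃ σ τ H : MvPolynomial (Fin n) ℝ,
        InCone f σ ∧ InCone f τ ∧ InIdeal h H ∧ p * σ = 1 + τ + H := by
  constructor
  · intro hpos
    refine (exists_certificate_or_preordering f h p).resolve_right ?_
    rintro ⟨P, hf, hh, hp⟩
    classical
    obtain ⟨x, hx⟩ := P.exists_eval_nonneg (insert (-p) (Finset.univ.image f ∪
      (Finset.univ.image h ∪ Finset.univ.image fun j => -h j)))
    have h1 := hx (-p) (by simp) hp
    have h2 := hpos x ⟨fun i => hx _ (by simp) (hf i), fun j => le_antisymm ?_ ?_⟩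
    · rw [map_neg] at h1
      linarith
    · have := hx (-h j) (by simp) (hh j).2
      rw [map_neg] at this
      linarith
    · exact hx _ (by simp) (hh j).1
  · rintro ⟨σ, τ, H, hσ, hτ, ⟨q, rfl⟩, heq⟩ x ⟨hf, hh⟩
    have h1 := congrArg (eval x) heq
    simp only [map_mul, map_add, map_one, map_sum, hh, mul_zero, Finset.sum_const_zero,
      add_zero] at h1
    by_contra! hle
    nlinarith [hσ.eval_nonneg hf, hτ.eval_nonneg hf]
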